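/- One has λ > 1, each K_k is finite, and there exists N₀ ∈ ℕ such that (K_{N₀} + 1)/λ^{N₀} < 1. -/

import Mathlib

open Filter Topology Set

noncomputable section

/-- The open unit square `M = (0,1)²`. -/
def unitOpenSq : Set (ℝ × ℝ) := Set.Ioo (0:ℝ) 1 ×ˢ Set.Ioo (0:ℝ) 1

/-- The closed unit square `[0,1]²`. -/
def unitSq : Set (ℝ × ℝ) := Set.Icc (0:ℝ) 1 ×ˢ Set.Icc (0:ℝ) 1

/-- The perturbed Arnold cat map `F_t(x,y) = ({x+y}, {x+(2−t)y})`. -/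
def catF (t : ℝ) (p : ℝ × ℝ) : ℝ × ℝ :=
  (Int.fract (p.1 + p.2), Int.fract (p.1 + (2 - t) * p.2))

/-- The discontinuity set `S_t^{+,1}` of `F_t` in `M`. -/
def Sone (t : ℝ) : Set (ℝ × ℝ) :=
  {p ∈ unitOpenSq | p.2 = (1 - p.1) / (2 - t) ∨ p.2 = (2 - p.1) / (2 - t) ∨ p.2 = 1 - p.1}

/-- `S_t⁺ = S_t^{+,1} ∪ ∂([0,1]²)`. -/
def Splus (t : ℝ) : Set (ℝ × ℝ) := Sone t ∪ frontier unitSq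

/-- `S_t^{+,k} = ⋃_{p=0}^{k−1} F_t^{−p}(S_t⁺) \ ∂([0,1]²)`. -/
def SkPlus (t : ℝ) (k : ℕ) : Set (ℝ × ℝ) :=
  (⋃ p ∈ Finset.range k, (catF t)^[p] ⁻¹' Splus t) \ frontier unitSq

/-- The matrix `A_t` acting on `ℝ²`. -/
def catA (t : ℝ) (v : ℝ × ℝ) : ℝ × ℝ := (v.1 + v.2, v.1 + (2 - t) * v.2)

/-- Euclidean length of a vector of `ℝ²`. -/
def elen (v : ℝ × ℝ) : ℝ := Real.sqrt (v.1 ^ 2 + v.2 ^ 2)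

/-- The minimal expansion `λ` of the matrices `A_t`, `t ∈ [0,1/8]`, on the unstable cone
`ξη ≥ 0` (with respect to the Euclidean norm). -/
def lam : ℝ :=
  sInf ((fun q : ℝ × (ℝ × ℝ) => elen (catA q.1 q.2) / elen q.2) ''
    {q : ℝ × (ℝ × ℝ) | q.1 ∈ Set.Icc (0:ℝ) (1/8) ∧ q.2 ≠ 0 ∧ 0 ≤ q.2.1 * q.2.2})

/-- The connected components of `M \ S_t^{+,k}` having `x` on their boundary. -/
def comps (t : ℝ) (k : ℕ) (x : ℝ × ℝ) : Set (Set (ℝ × ℝ)) :=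
  {O | (∃ y ∈ unitOpenSq \ SkPlus t k,
      O = connectedComponentIn (unitOpenSq \ SkPlus t k) y) ∧ x ∈ frontier O}

/-- The linear functional on `ℝ²` with coefficient row `r`. -/
def rowval (r y : ℝ × ℝ) : ℝ := r.1 * y.1 + r.2 * y.2

@[fun_prop]
lemma continuous_rowval (r : ℝ × ℝ) : Continuous (rowval r) := by
  unfold rowval; fun_prop

lemma rowval_smul_add_smul (r y z : ℝ × ℝ) (a b : ℝ) :
    rowval r (a • y + b • z) = a * rowval r y + b * rowval r z := by
  simp [rowval]; ring

lemma rowval_pos_of_slope_le_of_pos {r w w' : ℝ × ℝ} (hr : 0 ≤ r.2) (hw : 0 < w.1)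
    (hw' : 0 < w'.1) (h : w.2 * w'.1 ≤ w'.2 * w.1) (hp : 0 < rowval r w) :
    0 < rowval r w' := by
  unfold rowval at *
  refine pos_of_mul_pos_right (a := w.1) ?_ hw.le
  nlinarith [mul_pos hp hw', mul_le_mul_of_nonneg_left h hr]

lemma rowval_pos_of_slope_le_of_neg {r w w' : ℝ × ℝ} (hr : 0 ≤ r.2) (hw : w.1 < 0)
    (hw' : w'.1 < 0) (h : w'.2 * w.1 ≤ w.2 * w'.1) (hp : 0 < rowval r w) :
    0 < rowval r w' := by
  unfold rowval at *
  refine pos_of_mul_pos_right (a := -w.1) ?_ (by linarith)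
  nlinarith [mul_pos hp (neg_pos.2 hw'), mul_le_mul_of_nonneg_left h hr]

/-- On either open half plane `{w₁ > 0}`, `{w₁ < 0}`, the sets of positive functionals from a
family with nonnegative second coefficients form a chain, so they are determined by their
cardinality. -/
lemma filter_pos_eq_of_card_eq {ι : Type*} (J : Finset ι) (r : ι → ℝ × ℝ)
    (hr : ∀ j ∈ J, 0 ≤ (r j).2) {w w' : ℝ × ℝ} (hw : w.1 ≠ 0) (hw' : w'.1 ≠ 0)
    (hs : 0 < w.1 ↔ 0 < w'.1)
    (hc : (J.filter fun j => 0 < rowval (r j) w).card =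
      (J.filter fun j => 0 < rowval (r j) w').card) :
    (J.filter fun j => 0 < rowval (r j) w) = J.filter fun j => 0 < rowval (r j) w' := by
  have mono : ∀ {v v' : ℝ × ℝ}, (∀ j ∈ J, 0 < rowval (r j) v → 0 < rowval (r j) v') →
      (J.filter fun j => 0 < rowval (r j) v) ⊆ J.filter fun j => 0 < rowval (r j) v' := by
    intro v v' h j hj
    rw [Finset.mem_filter] at hj ⊢
    exact ⟨hj.1, h j hj.1 hj.2⟩
  have key : (J.filter fun j => 0 < rowval (r j) w) ⊆ (J.filter fun j => 0 < rowval (r j) w') ∨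
      (J.filter fun j => 0 < rowval (r j) w') ⊆ (J.filter fun j => 0 < rowval (r j) w) := by
    rcases lt_or_gt_of_ne hw with h | h
    · have h' : w'.1 < 0 := lt_of_le_of_ne (not_lt.1 (hs.not.1 h.not_gt)) hw'
      rcases le_total (w'.2 * w.1) (w.2 * w'.1) with hl | hl
      · refine Or.inl (mono fun j hj => ?_)
        exact rowval_pos_of_slope_le_of_neg (hr j hj) h h' hl
      · refine Or.inr (mono fun j hj => ?_)
        exact rowval_pos_of_slope_le_of_neg (hr j hj) h' h hl
    · have h' : 0 < w'.1 := hs.1 h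
      rcases le_total (w.2 * w'.1) (w'.2 * w.1) with hl | hl
      · refine Or.inl (mono fun j hj => ?_)
        exact rowval_pos_of_slope_le_of_pos (hr j hj) h h' hl
      · refine Or.inr (mono fun j hj => ?_)
        exact rowval_pos_of_slope_le_of_pos (hr j hj) h' h hl
  rcases key with h | h
  · exact Finset.eq_of_subset_of_card_le h hc.ge
  · exact (Finset.eq_of_subset_of_card_le h hc.le).symm

/-- A nonempty open set contains a point off any finite family of lines of negative slope. -/
lemma exists_mem_rowval_ne {ι : Type*} (J : Finset ι) (r : ι → ℝ × ℝ)
    (hr : ∀ j ∈ J, 0 < (r j).1 + (r j).2) (c : ι → ℝ) {V : Set (ℝ × ℝ)} (hV : IsOpen V)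
    (hne : V.Nonempty) : ∃ z ∈ V, ∀ j ∈ J, rowval (r j) z ≠ c j := by
  obtain ⟨y, hy⟩ := hne
  let g : ℝ → ℝ × ℝ := fun s => (y.1 + s, y.2 + s)
  have hg : Continuous g := by fun_prop
  have hg0 : g 0 = y := by simp [g]
  have hgr : ∀ j s, rowval (r j) (g s) = rowval (r j) y + s * ((r j).1 + (r j).2) := by
    intro j s; simp only [rowval, g]; ring
  have h1 : ∀ᶠ s in 𝓝[≠] (0:ℝ), g s ∈ V :=
    nhdsWithin_le_nhds (hg.continuousAt.eventually_mem (by rw [hg0]; exact hV.mem_nhds hy))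
  have h2 : ∀ᶠ s in 𝓝[≠] (0:ℝ), ∀ j ∈ J, rowval (r j) (g s) ≠ c j := by
    rw [Filter.eventually_all_finset]
    intro j hj
    by_cases h : rowval (r j) y = c j
    · filter_upwards [self_mem_nhdsWithin] with s hs
      rw [hgr, h]
      simpa using ⟨hs, (hr j hj).ne'⟩
    · refine nhdsWithin_le_nhds ?_
      have hc : Continuous fun s => rowval (r j) (g s) := by fun_prop
      exact hc.continuousAt.eventually_ne (by rwa [hg0])
  obtain ⟨s, hs1, hs2⟩ := (h1.and h2).exists
  exact ⟨g s, hs1, hs2⟩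

/-- If, near `x`, the complement of an open set `U` is contained in `m` lines through `x` of
nonpositive slope, one of which is vertical, then at most `2 (m + 1)` components of `U` have `x`
on their boundary. -/
lemma card_components_le {ι : Type*} (J : Finset ι) (r : ι → ℝ × ℝ)
    (hr : ∀ j ∈ J, 0 ≤ (r j).2) (hr' : ∀ j ∈ J, 0 < (r j).1 + (r j).2) {j₀ : ι} (hj₀ : j₀ ∈ J)
    (hrj₀ : r j₀ = (1, 0)) {U : Set (ℝ × ℝ)} (hU : IsOpen U) (x : ℝ × ℝ)
    (hx : ∀ᶠ y in 𝓝 x, (∀ j ∈ J, rowval (r j) y ≠ rowval (r j) x) → y ∈ U) :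
    {O | (∃ y ∈ U, O = connectedComponentIn U y) ∧ x ∈ frontier O}.Finite ∧
    {O | (∃ y ∈ U, O = connectedComponentIn U y) ∧ x ∈ frontier O}.ncard ≤
      2 * (J.card + 1) := by
  classical
  set S := {O | (∃ y ∈ U, O = connectedComponentIn U y) ∧ x ∈ frontier O}
  obtain ⟨ε, hε, hball⟩ := Metric.eventually_nhds_iff_ball.1 hx
  have hpt : ∀ O ∈ S, ∃ z, (z ∈ O ∧ z ∈ Metric.ball x ε) ∧
      ∀ j ∈ J, rowval (r j) z ≠ rowval (r j) x := by
    rintro O ⟨⟨y, -, rfl⟩, hxO⟩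
    refine exists_mem_rowval_ne J r hr' (fun j => rowval (r j) x)
      (V := connectedComponentIn U y ∩ Metric.ball x ε)
      (hU.connectedComponentIn.inter Metric.isOpen_ball) ?_
    rw [Set.inter_comm]
    exact mem_closure_iff.1 (frontier_subset_closure hxO) _ Metric.isOpen_ball
      (Metric.mem_ball_self hε)
  choose! z hz hzne using hpt
  have hsub : ∀ (q y : ℝ × ℝ), rowval q (y - x) = rowval q y - rowval q x := by
    intro q y; simp only [rowval, Prod.fst_sub, Prod.snd_sub]; ring
  let code : Set (ℝ × ℝ) → Bool × ℕ := fun O =>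
    (decide (0 < (z O - x).1), (J.filter fun j => 0 < rowval (r j) (z O - x)).card)
  have hmaps : ∀ O ∈ S, code O ∈
      (Finset.univ ×ˢ Finset.range (J.card + 1) : Finset (Bool × ℕ)) := by
    intro O _
    simp only [code, Finset.mem_product, Finset.mem_univ, true_and, Finset.mem_range]
    exact Nat.lt_succ_of_le (Finset.card_filter_le _ _)
  have hfst : ∀ O ∈ S, (z O - x).1 ≠ 0 := by
    intro O hO h
    have h1 := hzne O hO j₀ hj₀
    rw [hrj₀, ← sub_ne_zero, ← hsub] at h1
    exact h1 (by simp only [rowval, h]; ring)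
  have hinj : Set.InjOn code S := by
    intro O hO O' hO' h
    simp only [code, Prod.mk.injEq, decide_eq_decide] at h
    have hfilter := filter_pos_eq_of_card_eq J r hr (hfst O hO) (hfst O' hO') h.1 h.2
    have hseg : segment ℝ (z O) (z O') ⊆ U := by
      intro y hy
      have hyB : y ∈ Metric.ball x ε :=
        (convex_ball x ε).segment_subset (hz O hO).2 (hz O' hO').2 hy
      refine hball y hyB fun j hj => ?_
      obtain ⟨a, b, ha, hb, hab, rfl⟩ := hy
      rw [rowval_smul_add_smul]
      have hiff : 0 < rowval (r j) (z O - x) ↔ 0 < rowval (r j) (z O' - x) := by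
        have := Finset.ext_iff.1 hfilter j
        simpa [hj] using this
      rw [hsub, hsub, sub_pos, sub_pos] at hiff
      set c := rowval (r j) x
      have hc : c = a * c + b * c := by rw [← add_mul, hab, one_mul]
      rcases lt_or_gt_of_ne (hzne O hO j hj) with h1 | h1
      · have h2 : rowval (r j) (z O') < c :=
          lt_of_le_of_ne (not_lt.1 (hiff.not.1 h1.not_gt)) (hzne O' hO' j hj)
        rcases ha.eq_or_lt with rfl | ha
        · obtain rfl : b = 1 := by linarith
          linarith
        · nlinarith [mul_lt_mul_of_pos_left h1 ha, mul_le_mul_of_nonneg_left h2.le hb]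
      · have h2 : c < rowval (r j) (z O') := hiff.1 h1
        rcases ha.eq_or_lt with rfl | ha
        · obtain rfl : b = 1 := by linarith
          linarith
        · nlinarith [mul_lt_mul_of_pos_left h1 ha, mul_le_mul_of_nonneg_left h2.le hb]
    have hmem : z O' ∈ connectedComponentIn U (z O) :=
      (convex_segment (𝕜 := ℝ) (z O) (z O')).isPreconnected.subset_connectedComponentIn
        (left_mem_segment ℝ _ _) hseg (right_mem_segment ℝ _ _)
    have hzO := (hz O hO).1
    have hzO' := (hz O' hO').1
    obtain ⟨⟨y, -, hy⟩, -⟩ := hO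
    obtain ⟨⟨y', -, hy'⟩, -⟩ := hO'
    have e1 : O = connectedComponentIn U (z O) := by
      conv_lhs => rw [hy]
      exact connectedComponentIn_eq (hy ▸ hzO)
    have e2 : O' = connectedComponentIn U (z O') := by
      conv_lhs => rw [hy']
      exact connectedComponentIn_eq (hy' ▸ hzO')
    rw [e1, e2]
    exact connectedComponentIn_eq hmem
  refine ⟨Set.Finite.of_injOn (fun O hO => hmaps O hO) hinj (Finset.finite_toSet _), ?_⟩
  have := Set.ncard_le_ncard_of_injOn code (fun O hO => hmaps O hO) hinj (Finset.finite_toSet _)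
  rw [Set.ncard_coe_finset] at this
  simpa using this

lemma isOpen_unitOpenSq : IsOpen unitOpenSq := isOpen_Ioo.prod isOpen_Ioo

lemma interior_unitSq : interior unitSq = unitOpenSq := by
  rw [unitSq, unitOpenSq, interior_prod_eq, interior_Icc]

lemma isClosed_unitSq : IsClosed unitSq := isClosed_Icc.prod isClosed_Icc

lemma frontier_unitSq : frontier unitSq = unitSq \ unitOpenSq := by
  rw [isClosed_unitSq.frontier_eq, interior_unitSq]

lemma catF_mem_unitSq (t : ℝ) (y : ℝ × ℝ) : catF t y ∈ unitSq :=
  ⟨⟨Int.fract_nonneg _, (Int.fract_lt_one _).le⟩, ⟨Int.fract_nonneg _, (Int.fract_lt_one _).le⟩⟩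

lemma iterate_catF_mem_unitSq (t : ℝ) {y : ℝ × ℝ} (hy : y ∈ unitSq) (p : ℕ) :
    (catF t)^[p] y ∈ unitSq := by
  cases p with
  | zero => exact hy
  | succ p => rw [Function.iterate_succ_apply']; exact catF_mem_unitSq _ _

lemma rowval_catA (t : ℝ) (r y : ℝ × ℝ) : rowval r (catA t y) = rowval (catA t r) y := by
  simp only [rowval, catA]; ring

lemma mem_Sone_iff {t : ℝ} (ht : t ∈ Set.Icc (0:ℝ) (1/8)) (y : ℝ × ℝ) :
    y ∈ Sone t ↔ y ∈ unitOpenSq ∧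
      (y.1 + (2 - t) * y.2 = 1 ∨ y.1 + (2 - t) * y.2 = 2 ∨ y.1 + y.2 = 1) := by
  have h2 : 2 - t ≠ 0 := by linarith [ht.2]
  simp only [Sone, Set.mem_ofPred_eq, eq_div_iff h2]
  refine and_congr_right fun _ => or_congr ?_ (or_congr ?_ ?_) <;>
    constructor <;> intro h <;> linarith

lemma floors_mem {t : ℝ} (ht : t ∈ Set.Icc (0:ℝ) (1/8)) {y : ℝ × ℝ} (hy : y ∈ unitSq) :
    ⌊y.1 + y.2⌋ ∈ Set.Icc (0:ℤ) 3 ∧ ⌊y.1 + (2 - t) * y.2⌋ ∈ Set.Icc (0:ℤ) 3 := by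
  obtain ⟨⟨a, b⟩, c, d⟩ := hy
  obtain ⟨e, f⟩ := ht
  have h1 : 0 ≤ (2 - t) * y.2 := mul_nonneg (by linarith) c
  have h2 : (2 - t) * y.2 ≤ 2 * 1 := mul_le_mul (by linarith) d c (by norm_num)
  refine ⟨⟨Int.floor_nonneg.2 (by linarith), ?_⟩, ⟨Int.floor_nonneg.2 (by linarith), ?_⟩⟩ <;>
    · rw [← Int.lt_add_one_iff, Int.floor_lt]; push_cast; linarith

lemma exists_finite_rowval_catF {t : ℝ} (ht : t ∈ Set.Icc (0:ℝ) (1/8)) (r : ℝ × ℝ) :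
    ∃ D : Set ℝ, D.Finite ∧ ∀ y ∈ unitSq, rowval r (catF t y) - rowval (catA t r) y ∈ D := by
  refine ⟨Set.image2 (fun m n : ℤ => -(r.1 * m + r.2 * n)) (Set.Icc 0 3) (Set.Icc 0 3),
    (Set.finite_Icc _ _).image2 _ (Set.finite_Icc _ _), fun y hy => ?_⟩
  refine ⟨_, (floors_mem ht hy).1, _, (floors_mem ht hy).2, ?_⟩
  simp only [rowval, catF, catA, Int.fract]
  ring

lemma exists_finite_rowval_iterate {t : ℝ} (ht : t ∈ Set.Icc (0:ℝ) (1/8)) (r : ℝ × ℝ) (p : ℕ) :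
    ∃ D : Set ℝ, D.Finite ∧
      ∀ y ∈ unitSq, rowval r ((catF t)^[p] y) - rowval ((catA t)^[p] r) y ∈ D := by
  induction p with
  | zero => exact ⟨{0}, Set.finite_singleton _, fun y _ => by simp⟩
  | succ p ih =>
    obtain ⟨D, hD, h⟩ := ih
    obtain ⟨E, hE, h'⟩ := exists_finite_rowval_catF ht ((catA t)^[p] r)
    refine ⟨Set.image2 (· + ·) D E, hD.image2 _ hE, fun y hy => ?_⟩
    refine ⟨_, h (catF t y) (catF_mem_unitSq t y), _, h' y hy, ?_⟩
    rw [Function.iterate_succ_apply, Function.iterate_succ_apply']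
    ring

/-- The standard basis of `ℝ²`, indexed by `Bool`. -/
def basisRow (i : Bool) : ℝ × ℝ := if i then (1, 0) else (0, 1)

lemma rowval_of_mem_Splus {t : ℝ} (ht : t ∈ Set.Icc (0:ℝ) (1/8)) {y : ℝ × ℝ}
    (hy : y ∈ Splus t) : ∃ i, rowval (basisRow i) y ∈ ({0, 1, 2} : Set ℝ) ∨
      rowval (catA t (basisRow i)) y ∈ ({0, 1, 2} : Set ℝ) := by
  rcases hy with hy | hy
  · rcases ((mem_Sone_iff ht y).1 hy).2 with h | h | h
    · exact ⟨false, Or.inr (by simp [rowval, catA, basisRow, h])⟩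
    · exact ⟨false, Or.inr (by simp [rowval, catA, basisRow, h])⟩
    · exact ⟨true, Or.inr (by simp [rowval, catA, basisRow, h])⟩
  · rw [frontier_unitSq] at hy
    obtain ⟨⟨⟨a, b⟩, c, d⟩, h⟩ := hy
    by_contra hcon
    push Not at hcon
    have h1 := (hcon true).1
    have h2 := (hcon false).1
    simp only [rowval, basisRow, Set.mem_insert_iff, Set.mem_singleton_iff, if_true, one_mul,
      zero_mul, add_zero, zero_add, Bool.false_eq_true, if_false, not_or] at h1 h2
    exact h ⟨⟨lt_of_le_of_ne a (Ne.symm h1.1), lt_of_le_of_ne b h1.2.1⟩,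
      ⟨lt_of_le_of_ne c (Ne.symm h2.1), lt_of_le_of_ne d h2.2.1⟩⟩

/-- `S_t^{+,k}` lies in finitely many lines, with directions given by the rows of `A_t^q`,
`q ≤ k`. -/
lemma exists_finite_lines {t : ℝ} (ht : t ∈ Set.Icc (0:ℝ) (1/8)) (k : ℕ) :
    ∃ C : Set ℝ, C.Finite ∧ ∀ y ∈ unitSq, y ∈ SkPlus t k →
      ∃ j ∈ (Finset.univ ×ˢ Finset.range (k + 1) : Finset (Bool × ℕ)),
        rowval ((catA t)^[j.2] (basisRow j.1)) y ∈ C := by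
  choose D hD hDy using fun q : (ℝ × ℝ) × ℕ => exists_finite_rowval_iterate ht q.1 q.2
  let E : Bool × ℕ → Set ℝ := fun j =>
    Set.image2 (fun a d => a - d) {0, 1, 2} (D (basisRow j.1, j.2)) ∪
    Set.image2 (fun a d => a - d) {0, 1, 2} (D (catA t (basisRow j.1), j.2))
  refine ⟨⋃ j ∈ (Finset.univ ×ˢ Finset.range k : Finset (Bool × ℕ)), E j, ?_, ?_⟩
  · refine Set.Finite.biUnion (Finset.finite_toSet _) fun j _ => ?_
    exact ((Set.toFinite _).image2 _ (hD _)).union ((Set.toFinite _).image2 _ (hD _))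
  · rintro y hy ⟨hyS, -⟩
    simp only [Set.mem_iUnion, Set.mem_preimage, Finset.mem_range, exists_prop] at hyS
    obtain ⟨p, hp, hyp⟩ := hyS
    have hmem : ∀ i, (i, p) ∈ (Finset.univ ×ˢ Finset.range k : Finset (Bool × ℕ)) := by
      simp [hp]
    obtain ⟨i, h | h⟩ := rowval_of_mem_Splus ht hyp
    · refine ⟨(i, p), by simp; omega, Set.mem_biUnion (hmem i) (Or.inl ?_)⟩
      exact ⟨_, h, _, hDy (basisRow i, p) y hy, by simp⟩
    · refine ⟨(i, p + 1), by simp; omega, Set.mem_biUnion (hmem i) (Or.inr ?_)⟩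
      refine ⟨_, h, _, hDy (catA t (basisRow i), p) y hy, ?_⟩
      simp [Function.iterate_succ_apply]

lemma iterate_catA_basisRow {t : ℝ} (ht : t ∈ Set.Icc (0:ℝ) (1/8)) (i : Bool) (q : ℕ) :
    0 ≤ ((catA t)^[q] (basisRow i)).1 ∧ 0 ≤ ((catA t)^[q] (basisRow i)).2 ∧
      0 < ((catA t)^[q] (basisRow i)).1 + ((catA t)^[q] (basisRow i)).2 := by
  induction q with
  | zero => cases i <;> simp [basisRow]
  | succ q ih =>
    rw [Function.iterate_succ_apply']
    obtain ⟨h1, h2, h3⟩ := ih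
    have := mul_nonneg (show 0 ≤ 2 - t by linarith [ht.2]) h2
    simp only [catA]
    exact ⟨by linarith, by linarith, by linarith⟩

lemma continuousAt_catF {t : ℝ} (ht : t ∈ Set.Icc (0:ℝ) (1/8)) {y : ℝ × ℝ}
    (hy : y ∈ unitOpenSq) (hy' : y ∉ Sone t) : ContinuousAt (catF t) y := by
  have hn : ¬ (y.1 + (2 - t) * y.2 = 1 ∨ y.1 + (2 - t) * y.2 = 2 ∨ y.1 + y.2 = 1) :=
    fun h => hy' ((mem_Sone_iff ht y).2 ⟨hy, h⟩)
  push Not at hn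
  obtain ⟨⟨a, b⟩, c, d⟩ := hy
  obtain ⟨e, f⟩ := ht
  have h1 : 0 < (2 - t) * y.2 := mul_pos (by linarith) c
  have h2 : (2 - t) * y.2 ≤ 2 * y.2 := mul_le_mul_of_nonneg_right (by linarith) c.le
  have ne1 : Int.fract (y.1 + y.2) ≠ 0 := by
    intro h
    obtain ⟨m, hm⟩ := Int.fract_eq_zero_iff.1 h
    have l1 : (0:ℝ) < m := by rw [hm]; linarith
    have l2 : (m:ℝ) < 2 := by rw [hm]; linarith
    have : m = 1 := by
      have : 0 < m := by exact_mod_cast l1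
      have : m < 2 := by exact_mod_cast l2
      omega
    subst this
    exact hn.2.2 (by rw [← hm]; norm_num)
  have ne2 : Int.fract (y.1 + (2 - t) * y.2) ≠ 0 := by
    intro h
    obtain ⟨m, hm⟩ := Int.fract_eq_zero_iff.1 h
    have l1 : (0:ℝ) < m := by rw [hm]; linarith
    have l2 : (m:ℝ) < 3 := by rw [hm]; linarith
    have : m = 1 ∨ m = 2 := by
      have : 0 < m := by exact_mod_cast l1
      have : m < 3 := by exact_mod_cast l2
      omega
    rcases this with rfl | rfl
    · exact hn.1 (by rw [← hm]; norm_num)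
    · exact hn.2.1 (by rw [← hm]; norm_num)
  have fc : ∀ v : ℝ, Int.fract v ≠ 0 → ContinuousAt (Int.fract : ℝ → ℝ) v := by
    intro v hv
    have hlt : (⌊v⌋ : ℝ) < v := lt_of_le_of_ne (Int.floor_le v) fun h => hv (by
      rw [Int.fract, ← h]; simp)
    refine (continuousOn_fract ⌊v⌋).continuousAt ?_
    exact Ico_mem_nhds hlt (Int.lt_floor_add_one v)
  refine ContinuousAt.prodMk ?_ ?_
  · exact ContinuousAt.comp (f := fun p : ℝ × ℝ => p.1 + p.2) (fc _ ne1) (by fun_prop)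
  · exact ContinuousAt.comp (f := fun p : ℝ × ℝ => p.1 + (2 - t) * p.2) (fc _ ne2) (by fun_prop)

lemma isClosed_Splus {t : ℝ} (ht : t ∈ Set.Icc (0:ℝ) (1/8)) : IsClosed (Splus t) := by
  have : Splus t = frontier unitSq ∪ (unitSq ∩
      {y | y.1 + (2 - t) * y.2 = 1 ∨ y.1 + (2 - t) * y.2 = 2 ∨ y.1 + y.2 = 1}) := by
    ext y
    have hsub : y ∈ unitOpenSq → y ∈ unitSq := fun h => by
      rw [← interior_unitSq] at h; exact interior_subset h
    simp only [Splus, Set.mem_union, mem_Sone_iff ht, frontier_unitSq, Set.mem_inter_iff,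
      Set.mem_sdiff, Set.mem_ofPred_eq]
    tauto
  rw [this]
  refine isClosed_frontier.union (isClosed_unitSq.inter ?_)
  refine (isClosed_eq ?_ ?_).union ((isClosed_eq ?_ ?_).union (isClosed_eq ?_ ?_)) <;> fun_prop

lemma mem_unitOpenSq_of_notMem_Splus {t : ℝ} {y : ℝ × ℝ} (hy : y ∈ unitSq) (h : y ∉ Splus t) :
    y ∈ unitOpenSq ∧ y ∉ Sone t := by
  simp only [Splus, frontier_unitSq, Set.mem_union, Set.mem_sdiff] at h
  tauto

lemma unitOpenSq_subset_unitSq : unitOpenSq ⊆ unitSq :=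
  interior_unitSq ▸ interior_subset

lemma mem_sdiff_SkPlus_iff {t : ℝ} {k : ℕ} {y : ℝ × ℝ} (hy : y ∈ unitOpenSq) :
    y ∈ unitOpenSq \ SkPlus t k ↔ ∀ p < k, (catF t)^[p] y ∉ Splus t := by
  have : y ∉ frontier unitSq := by rw [frontier_unitSq]; exact fun h => h.2 hy
  simp [SkPlus, hy, this]

lemma isOpen_sdiff_SkPlus {t : ℝ} (ht : t ∈ Set.Icc (0:ℝ) (1/8)) (k : ℕ) :
    IsOpen (unitOpenSq \ SkPlus t k) := by
  rw [isOpen_iff_mem_nhds]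
  intro y hyU
  have hy := hyU.1
  have hyp := (mem_sdiff_SkPlus_iff hy).1 hyU
  have hcont : ∀ p ≤ k, ContinuousAt (catF t)^[p] y := by
    intro p
    induction p with
    | zero => intro _; exact continuousAt_id
    | succ p ih =>
      intro hp
      rw [Function.iterate_succ']
      have h := mem_unitOpenSq_of_notMem_Splus
        (iterate_catF_mem_unitSq t (unitOpenSq_subset_unitSq hy) p) (hyp p hp)
      exact ContinuousAt.comp (continuousAt_catF ht h.1 h.2) (ih (Nat.le_of_succ_le hp))
  have hev : ∀ᶠ w in 𝓝 y, ∀ p ∈ Finset.range k, (catF t)^[p] w ∉ Splus t := by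
    rw [Filter.eventually_all_finset]
    intro p hp
    rw [Finset.mem_range] at hp
    exact (hcont p hp.le).eventually_mem ((isClosed_Splus ht).isOpen_compl.mem_nhds (hyp p hp))
  filter_upwards [hev, isOpen_unitOpenSq.mem_nhds hy] with w hw hwM
  exact (mem_sdiff_SkPlus_iff hwM).2 fun p hp => hw p (Finset.mem_range.2 hp)

/-- The complexity grows at most linearly. -/
lemma card_comps_le {t : ℝ} (ht : t ∈ Set.Icc (0:ℝ) (1/8)) (k : ℕ) {x : ℝ × ℝ}
    (hx : x ∈ SkPlus t k) :
    (comps t k x).Finite ∧ (comps t k x).ncard ≤ 4 * k + 6 := by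
  by_cases hxM : x ∈ unitOpenSq
  · obtain ⟨C, hC, hlines⟩ := exists_finite_lines ht k
    have := card_components_le (Finset.univ ×ˢ Finset.range (k + 1) : Finset (Bool × ℕ))
      (fun j => (catA t)^[j.2] (basisRow j.1)) (fun j _ => (iterate_catA_basisRow ht j.1 j.2).2.1)
      (fun j _ => (iterate_catA_basisRow ht j.1 j.2).2.2) (j₀ := (true, 0)) (by simp)
      (by simp [basisRow]) (isOpen_sdiff_SkPlus ht k) x ?_
    · refine ⟨this.1, this.2.trans ?_⟩
      simp only [Finset.card_product, Finset.card_univ, Fintype.card_bool, Finset.card_range]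
      omega
    · have hev : ∀ᶠ y in 𝓝 x, ∀ j ∈ (Finset.univ ×ˢ Finset.range (k + 1) : Finset (Bool × ℕ)),
          rowval ((catA t)^[j.2] (basisRow j.1)) y ∉
            C \ {rowval ((catA t)^[j.2] (basisRow j.1)) x} := by
        rw [Filter.eventually_all_finset]
        intro j _
        refine (continuous_rowval _).continuousAt.eventually_mem
          ((hC.subset Set.sdiff_subset).isClosed.isOpen_compl.mem_nhds ?_)
        simp
      filter_upwards [hev, isOpen_unitOpenSq.mem_nhds hxM] with y hy hyM hne
      refine ⟨hyM, fun hyS => ?_⟩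
      obtain ⟨j, hj, hjC⟩ := hlines y (unitOpenSq_subset_unitSq hyM) hyS
      exact hy j hj ⟨hjC, hne j hj⟩
  · have : comps t k x = ∅ := by
      refine Set.eq_empty_of_forall_notMem ?_
      rintro O ⟨⟨y, -, rfl⟩, hxO⟩
      have hsub : connectedComponentIn (unitOpenSq \ SkPlus t k) y ⊆ unitSq :=
        (connectedComponentIn_subset _ _).trans (Set.sdiff_subset.trans unitOpenSq_subset_unitSq)
      have hxc : x ∈ unitSq :=
        closure_minimal hsub isClosed_unitSq (frontier_subset_closure hxO)
      exact hx.2 (frontier_unitSq ▸ ⟨hxc, hxM⟩)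
    simp [this]

lemma sqrt_two_le_lam : Real.sqrt 2 ≤ lam := by
  refine le_csInf ?_ ?_
  · exact ⟨_, (0, (1, 0)), ⟨by norm_num, by simp, by norm_num⟩, rfl⟩
  · rintro _ ⟨⟨t, a, b⟩, ⟨⟨ht0, ht1⟩, hv, hab⟩, rfl⟩
    simp only at ht0 ht1 hv hab
    have hpos : 0 < a ^ 2 + b ^ 2 := by
      rcases eq_or_ne a 0 with rfl | ha
      · have : b ≠ 0 := by rintro rfl; exact hv rfl
        positivity
      · positivity
    unfold elen
    rw [le_div_iff₀ (Real.sqrt_pos.2 hpos), ← Real.sqrt_mul (by norm_num)]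
    refine Real.sqrt_le_sqrt ?_
    simp only [catA]
    nlinarith [mul_nonneg hab (show 0 ≤ 2 - t by linarith),
      mul_nonneg (sq_nonneg b) (show 0 ≤ (2 - t) ^ 2 - 1 by nlinarith)]

/-- `λ > 1`, each complexity `K_k` is finite, and there is `N₀` with
`(K_{N₀} + 1)/λ^{N₀} < 1` (hyperbolicity beats cutting). -/
theorem hyperbolicity_beats_cutting :
    1 < lam ∧
    (∀ k : ℕ, 1 ≤ k → ∃ K : ℕ, ∀ t ∈ Set.Icc (0:ℝ) (1/8), ∀ x ∈ SkPlus t k,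
      (comps t k x).Finite ∧ (comps t k x).ncard ≤ K) ∧
    ∃ N₀ : ℕ, 1 ≤ N₀ ∧ ∃ K : ℕ,
      (∀ t ∈ Set.Icc (0:ℝ) (1/8), ∀ x ∈ SkPlus t N₀,
        (comps t N₀ x).Finite ∧ (comps t N₀ x).ncard ≤ K) ∧
      ((K : ℝ) + 1) / lam ^ N₀ < 1 := by
  have hlam := sqrt_two_le_lam
  have hs : (1:ℝ) < Real.sqrt 2 := Real.lt_sqrt_of_sq_lt (by norm_num)
  refine ⟨hs.trans_le hlam, fun k _ => ⟨4 * k + 6, fun t ht x hx => card_comps_le ht k hx⟩,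
    12, by norm_num, 4 * 12 + 6, fun t ht x hx => card_comps_le ht 12 hx, ?_⟩
  have hpow : (64:ℝ) ≤ lam ^ 12 := by
    calc (64:ℝ) = (Real.sqrt 2 ^ 2) ^ 6 := by rw [Real.sq_sqrt (by norm_num)]; norm_num
      _ = Real.sqrt 2 ^ 12 := by ring
      _ ≤ lam ^ 12 := by gcongr
  rw [div_lt_one (by linarith)]
  refine lt_of_lt_of_le ?_ hpow
  norm_num
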